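/- arXiv:1907.06032 — 2 statements merged into one kernel-verified Lean document; each statement's English description precedes it below -/
import Mathlib

section
/- Suppose a finite family X of nonzero vectors in ℝ^m has a minimal subspace segmentation that is intersected nondegenerately and satisfies the non-intersection condition. Then X has exactly one minimal subspace segmentation satisfying the non-intersection condition (namely that one). -/
open Submodule Module Finset

noncomputable section

variable {m : ℕ} {ι : Type*}

/-- The subspace spanned by the subfamily of `x` indexed by `S`. -/
def spanOf (x : ι → EuclideanSpace ℝ (Fin m)) (S : Finset ι) :
    Submodule ℝ (EuclideanSpace ℝ (Fin m)) :=
  Submodule.span ℝ (x '' (S : Set ι))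

/-- The rank `r(X_S)` of the subfamily of `x` indexed by `S`. -/
def rOf (x : ι → EuclideanSpace ℝ (Fin m)) (S : Finset ι) : ℕ :=
  Module.finrank ℝ (spanOf x S)

/-- `X_S` is nondegenerate: every subfamily `X_T`, `T ⊆ S`, has rank `min |T| r(X_S)`. -/
def Nondeg (x : ι → EuclideanSpace ℝ (Fin m)) (S : Finset ι) : Prop :=
  ∀ T ⊆ S, rOf x T = min T.card (rOf x S)

/-- `span(X_S)` is a minimal sample subspace: `n(X_S) > r(X_S)` and `X_S` is nondegenerate. -/
def IsMinimalSeg (x : ι → EuclideanSpace ℝ (Fin m)) (S : Finset ι) : Prop :=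
  rOf x S < S.card ∧ Nondeg x S

/-- `span(X_S)` is pure: the subfamily `X_S` is linearly independent. -/
def IsPureSeg (x : ι → EuclideanSpace ℝ (Fin m)) (S : Finset ι) : Prop :=
  LinearIndependent ℝ (fun i : {a // a ∈ S} => x i.1)

/-- A minimal subspace segmentation (MSS) `{J_0, J_1, …, J_K}` of the index set
(the pure piece `J_0` may be absent, i.e. empty). -/
structure IsMSS (x : ι → EuclideanSpace ℝ (Fin m)) (K : ℕ) (J0 : Finset ι)
    (P : Fin K → Finset ι) : Prop where
  cover : ∀ i : ι, i ∈ J0 ∨ ∃ k, i ∈ P k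
  disj0 : ∀ k, Disjoint J0 (P k)
  disj : ∀ k ℓ, k ≠ ℓ → Disjoint (P k) (P ℓ)
  pure0 : IsPureSeg x J0
  minimal : ∀ k, IsMinimalSeg x (P k)
  distinct : ∀ k ℓ, k ≠ ℓ → spanOf x (P k) ≠ spanOf x (P ℓ)
  distinct0 : J0.Nonempty → ∀ k, spanOf x J0 ≠ spanOf x (P k)
  sep0 : ∀ j ∈ J0, ∀ k, x j ∉ spanOf x (P k)

/-- The non-intersection condition: no sample lies in the intersection of the spans of
two distinct pieces of the segmentation `{J_0, J_1, …, J_K}`. -/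
def NonIntersectM (x : ι → EuclideanSpace ℝ (Fin m)) {K : ℕ} (J0 : Finset ι)
    (P : Fin K → Finset ι) : Prop :=
  (∀ (j : ι) (k ℓ : Fin K), k ≠ ℓ → x j ∉ spanOf x (P k) ⊓ spanOf x (P ℓ)) ∧
    (∀ (j : ι) (k : Fin K), x j ∉ spanOf x J0 ⊓ spanOf x (P k))

/-- The component of `x i` in the orthogonal complement of `W ⊓ S'` within `W`. -/
def zComp (x : ι → EuclideanSpace ℝ (Fin m))
    (W S' : Submodule ℝ (EuclideanSpace ℝ (Fin m))) (i : ι) :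
    EuclideanSpace ℝ (Fin m) :=
  (orthogonalProjection (W ⊓ (W ⊓ S')ᗮ) (x i) : EuclideanSpace ℝ (Fin m))

/-- The segmentation `{X_1, …, X_K}` is intersected nondegenerately: for every `k` and every
subfamily indexed by `S` disjoint from `P k`, the family of components of the vectors of `X_k`
in the orthogonal complement (within `span(X_k)`) of `span(X_k) ⊓ span(X_S)` is zero or
nondegenerate. -/
def IntNondeg (x : ι → EuclideanSpace ℝ (Fin m)) {K : ℕ}
    (P : Fin K → Finset ι) : Prop :=
  ∀ (k : Fin K) (S : Finset ι), Disjoint S (P k) →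
    (∀ i ∈ P k, zComp x (spanOf x (P k)) (spanOf x S) i = 0) ∨
      Nondeg (zComp x (spanOf x (P k)) (spanOf x S)) (P k)

section Helpers

variable {x : ι → EuclideanSpace ℝ (Fin m)} {S T : Finset ι}

theorem mem_spanOf {i : ι} (hi : i ∈ S) : x i ∈ spanOf x S :=
  subset_span ⟨i, hi, rfl⟩

theorem spanOf_mono (h : S ⊆ T) : spanOf x S ≤ spanOf x T :=
  span_mono (Set.image_mono h)

theorem spanOf_le_iff {W : Submodule ℝ (EuclideanSpace ℝ (Fin m))} :
    spanOf x S ≤ W ↔ ∀ i ∈ S, x i ∈ W := by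
  simp [spanOf, span_le, Set.subset_def]

theorem spanOf_union [DecidableEq ι] : spanOf x (S ∪ T) = spanOf x S ⊔ spanOf x T := by
  simp [spanOf, Set.image_union, span_union]

theorem spanOf_comp
    (f : EuclideanSpace ℝ (Fin m) →ₗ[ℝ] EuclideanSpace ℝ (Fin m)) :
    spanOf (fun i => f (x i)) S = (spanOf x S).map f := by
  simp only [spanOf, map_span, ← Set.image_comp]
  rfl

theorem IsPureSeg.rOf_eq_card (h : IsPureSeg x S) : rOf x S = S.card := by
  have := finrank_span_eq_card h
  rw [rOf, spanOf, Set.image_eq_range]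
  simpa using this

theorem IsMinimalSeg.not_subset_of_isPureSeg (hS : IsMinimalSeg x S) (hT : IsPureSeg x T) :
    ¬ S ⊆ T := fun hST => by
  have hS' : IsPureSeg x S := hT.comp (Set.inclusion hST) (Set.inclusion_injective hST)
  exact hS.1.ne hS'.rOf_eq_card

/-- A minimal subfamily of a minimal family spans the same subspace. -/
theorem IsMinimalSeg.spanOf_eq_of_subset (hS : IsMinimalSeg x S) (hT : IsMinimalSeg x T)
    (hST : S ⊆ T) : spanOf x S = spanOf x T := by
  refine Submodule.eq_of_le_of_finrank_eq (spanOf_mono hST) ?_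
  have h := hT.2 S hST
  have h1 := hS.1
  simp only [rOf] at h h1 ⊢
  omega

theorem mem_of_starProjection_eq_zero {W N : Submodule ℝ (EuclideanSpace ℝ (Fin m))}
    (hN : N ≤ W) {u : EuclideanSpace ℝ (Fin m)} (hu : u ∈ W)
    (h : (W ⊓ Nᗮ).starProjection u = 0) : u ∈ N := by
  rw [starProjection_apply_eq_zero_iff] at h
  obtain ⟨n, hn, p, hp, rfl⟩ := N.exists_add_mem_mem_orthogonal u
  have hpW : p ∈ W := by simpa using W.sub_mem hu (hN hn)
  have h0 := h p ⟨hpW, hp⟩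
  rw [inner_add_right, real_inner_comm, hp n hn, zero_add, inner_self_eq_zero] at h0
  simpa [h0] using hn

/-- If an independent part `A` of `S` becomes dependent with the samples outside `S` indexed by
`B`, then intersected nondegeneracy forces `A ∪ B` to span all of `spanOf x S`. -/
theorem spanOf_le_of_dependent [DecidableEq ι] {A B : Finset ι} (hAS : A ⊆ S)
    (hA : A.card = rOf x A)
    (hAB : spanOf x A ⊓ spanOf x B ≠ ⊥)
    (hZ : (∀ i ∈ S, zComp x (spanOf x S) (spanOf x B) i = 0) ∨
      Nondeg (zComp x (spanOf x S) (spanOf x B)) S) :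
    spanOf x S ≤ spanOf x (A ∪ B) := by
  set W := spanOf x S with hW
  set N := W ⊓ spanOf x B with hNdef
  set f := ((W ⊓ Nᗮ).starProjection : _ →L[ℝ] _).toLinearMap with hf
  have hz : zComp x W (spanOf x B) = fun i => f (x i) := rfl
  have hmap : W.map f = (spanOf x A).map f := by
    refine le_antisymm ?_ (map_mono (spanOf_mono hAS))
    rcases hZ with h0 | hN
    · rw [map_le_iff_le_comap, hW, spanOf_le_iff]
      intro i hi
      have : f (x i) = 0 := h0 i hi
      simp [this]
    · obtain ⟨v, ⟨hvA, hvB⟩, hv0⟩ := exists_mem_ne_zero_of_ne_bot hAB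
      have hfv : f v = 0 := by
        refine (starProjection_apply_eq_zero_iff _).2 fun w hw => ?_
        rw [real_inner_comm]
        exact hw.2 v ⟨spanOf_mono hAS hvA, hvB⟩
      have hlt : finrank ℝ ((spanOf x A).map f) < finrank ℝ (spanOf x A) := by
        have hrn := (f.domRestrict (spanOf x A)).finrank_range_add_finrank_ker
        rw [LinearMap.range_domRestrict] at hrn
        have : 0 < finrank ℝ (f.domRestrict (spanOf x A)).ker := by
          refine Module.finrank_pos_iff_exists_ne_zero.2 ?_
          exact ⟨⟨⟨v, hvA⟩, hfv⟩, fun h => hv0 (by simpa using congrArg (fun t => t.1.1) h)⟩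
        omega
      have hr := hN A hAS
      rw [hz, rOf, rOf, spanOf_comp, spanOf_comp] at hr
      rw [rOf] at hA
      refine (Submodule.eq_of_le_of_finrank_eq (map_mono (spanOf_mono hAS)) ?_).ge
      omega
  intro w hw
  obtain ⟨a, ha, hfa⟩ : f w ∈ (spanOf x A).map f := hmap ▸ mem_map_of_mem hw
  have hmem : w - a ∈ N := by
    refine mem_of_starProjection_eq_zero inf_le_left (W.sub_mem hw (spanOf_mono hAS ha)) ?_
    change f (w - a) = 0
    rw [map_sub, hfa, sub_self]
  rw [spanOf_union, ← add_sub_cancel a w]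
  exact add_mem_sup ha hmem.2

/-- A minimal family that meets `S` without being contained in it spans all of `spanOf x S`, if
`S` is intersected nondegenerately. -/
theorem IsMinimalSeg.spanOf_le [DecidableEq ι] {Q : Finset ι} (hQ : IsMinimalSeg x Q)
    (hx : ∀ j, x j ≠ 0) {a b : ι} (haQ : a ∈ Q) (haS : a ∈ S) (hbQ : b ∈ Q) (hbS : b ∉ S)
    (hZ : ∀ B : Finset ι, Disjoint B S →
      (∀ i ∈ S, zComp x (spanOf x S) (spanOf x B) i = 0) ∨
        Nondeg (zComp x (spanOf x S) (spanOf x B)) S) :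
    spanOf x S ≤ spanOf x Q := by
  have hab : a ≠ b := fun h => hbS (h ▸ haS)
  have hr : 1 ≤ rOf x Q := by
    rw [rOf, Submodule.one_le_finrank_iff]
    exact fun h => hx a ((Submodule.eq_bot_iff _).1 h _ (mem_spanOf haQ))
  obtain ⟨C, habC, hCQ, hC⟩ := exists_subsuperset_card_eq (s := {a, b}) (t := Q)
    (n := rOf x Q + 1) (by simp [insert_subset_iff, haQ, hbQ])
    (by rw [card_pair hab]; omega) hQ.1
  have haA : a ∈ C ∩ S := by simp [haS, habC (mem_insert_self a {b})]
  have hbB : b ∈ C \ S := by simp [hbS, habC (mem_insert_of_mem (mem_singleton_self b))]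
  have hcard := card_inter_add_card_sdiff C S
  have hA0 := card_pos.2 ⟨a, haA⟩
  have hB0 := card_pos.2 ⟨b, hbB⟩
  have hA := hQ.2 (C ∩ S) (inter_subset_left.trans hCQ)
  have hB := hQ.2 (C \ S) (sdiff_subset.trans hCQ)
  have hC' := hQ.2 C hCQ
  have hU : C ∩ S ∪ C \ S = C := by grind
  refine (spanOf_le_of_dependent (A := C ∩ S) inter_subset_right (by omega) ?_
    (hZ (C \ S) sdiff_disjoint)).trans (by rw [hU]; exact spanOf_mono hCQ)
  intro hbot
  have h := Submodule.finrank_sup_add_finrank_inf_eq (spanOf x (C ∩ S)) (spanOf x (C \ S))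
  rw [hbot, ← spanOf_union, hU, finrank_bot] at h
  simp only [rOf] at *
  omega

theorem IsMSS.mem_of_mem_spanOf {K : ℕ} {J0 : Finset ι} {P : Fin K → Finset ι}
    (h : IsMSS x K J0 P) (hni : NonIntersectM x J0 P) {j : ι} {k : Fin K}
    (hj : x j ∈ spanOf x (P k)) : j ∈ P k := by
  rcases h.cover j with h0 | ⟨l, hl⟩
  · exact absurd hj (h.sep0 j h0 k)
  · by_cases hkl : k = l
    · exact hkl ▸ hl
    · exact absurd ⟨hj, mem_spanOf hl⟩ (hni.1 j k l hkl)

theorem IsMSS.subset_of_spanOf_le {K : ℕ} {J0 : Finset ι} {P : Fin K → Finset ι}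
    (h : IsMSS x K J0 P) (hni : NonIntersectM x J0 P) {k : Fin K}
    (hS : spanOf x S ≤ spanOf x (P k)) : S ⊆ P k :=
  fun _ hj => h.mem_of_mem_spanOf hni (hS (mem_spanOf hj))

theorem IsMSS.mem_iff {K : ℕ} {J0 : Finset ι} {P : Fin K → Finset ι}
    (h : IsMSS x K J0 P) {j : ι} : j ∈ J0 ↔ ∀ k, j ∉ P k := by
  refine ⟨fun hj k => disjoint_left.1 (h.disj0 k) hj, fun hj => ?_⟩
  exact (h.cover j).resolve_right fun ⟨k, hk⟩ => hj k hk

theorem IsMSS.injective {K : ℕ} {J0 : Finset ι} {P : Fin K → Finset ι}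
    (h : IsMSS x K J0 P) : Function.Injective P := fun k l hkl => by
  by_contra hne
  exact h.distinct k l hne (by rw [hkl])

end Helpers

/-- If `X` has an MSS that is intersected nondegenerately and satisfies the
non-intersection condition, then its MSS satisfying the non-intersection condition is unique. -/
theorem mss_unique_of_intNondeg [Fintype ι]
    (x : ι → EuclideanSpace ℝ (Fin m)) (hx : ∀ j, x j ≠ 0)
    {K : ℕ} {J0 : Finset ι} {P : Fin K → Finset ι}
    (hmss : IsMSS x K J0 P) (hni : NonIntersectM x J0 P) (hnd : IntNondeg x P) :
    ∀ (K' : ℕ) (J0' : Finset ι) (P' : Fin K' → Finset ι),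
      IsMSS x K' J0' P' → NonIntersectM x J0' P' →
      J0' = J0 ∧ ∃ e : Fin K' ≃ Fin K, ∀ k', P (e k') = P' k' := by
  classical
  intro K' J0' P' hmss' hni'
  have hex : ∀ k', ∃ k, P k = P' k' := by
    intro k'
    have hQ := hmss'.minimal k'
    obtain ⟨a, haQ, ha0⟩ := not_subset.1 (hQ.not_subset_of_isPureSeg hmss.pure0)
    obtain ⟨k, hak⟩ := (hmss.cover a).resolve_left ha0
    have hspan : spanOf x (P k) = spanOf x (P' k') := by
      by_cases hsub : P' k' ⊆ P k
      · exact (hQ.spanOf_eq_of_subset (hmss.minimal k) hsub).symm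
      · obtain ⟨b, hbQ, hbk⟩ := not_subset.1 hsub
        exact (hmss.minimal k).spanOf_eq_of_subset hQ
          (hmss'.subset_of_spanOf_le hni' (hQ.spanOf_le hx haQ hak hbQ hbk (hnd k)))
    exact ⟨k, (hmss'.subset_of_spanOf_le hni' hspan.le).antisymm
      (hmss.subset_of_spanOf_le hni hspan.ge)⟩
  choose g hg using hex
  have hinj : Function.Injective g := fun k l hkl =>
    hmss'.injective (by rw [← hg, ← hg, hkl])
  have hsurj : Function.Surjective g := by
    intro k
    obtain ⟨a, hak, ha0⟩ := not_subset.1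
      ((hmss.minimal k).not_subset_of_isPureSeg hmss'.pure0)
    obtain ⟨k', hak'⟩ := (hmss'.cover a).resolve_left ha0
    refine ⟨k', ?_⟩
    by_contra hne
    exact disjoint_left.1 (hmss.disj _ _ hne) (hg k' ▸ hak') hak
  refine ⟨?_, Equiv.ofBijective g ⟨hinj, hsurj⟩, hg⟩
  ext j
  simp only [hmss.mem_iff, hmss'.mem_iff, hsurj.forall, hg]
end
end

section
/- Assume X has a minimal subspace segmentation {X_1, …, X_K} with no pure segment that is intersected nondegenerately, and let J = {J_1, …, J_K} be a partition of the index set. Suppose a piece J_i is extendable, i.e., some sample x_j with j ∉ J_i satisfies x_j ∈ span(X_{J_i}), and let J̃_i = J_i ∪ { j : x_j ∈ span(X_{J_i}) } be its extension. Then for every k ∈ {1, …, K}, either J̃_i ∩ J_k* = J_i ∩ J_k* or J̃_i ∩ J_k* = J_k*. -/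
open Submodule Module Finset

noncomputable section

variable {m : ℕ} {ι : Type*}

/-- A minimal subspace segmentation of `X` with no pure segment, with index pieces
`P 1, …, P K`. -/
structure IsMSSnp (x : ι → EuclideanSpace ℝ (Fin m)) {K : ℕ}
    (P : Fin K → Finset ι) : Prop where
  cover : ∀ i : ι, ∃ k, i ∈ P k
  disj : ∀ k ℓ, k ≠ ℓ → Disjoint (P k) (P ℓ)
  minimal : ∀ k, IsMinimalSeg x (P k)
  distinct : ∀ k ℓ, k ≠ ℓ → spanOf x (P k) ≠ spanOf x (P ℓ)

/-- The non-intersection condition for the minimal segments. -/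
def NonIntersect (x : ι → EuclideanSpace ℝ (Fin m)) {K : ℕ}
    (P : Fin K → Finset ι) : Prop :=
  ∀ (j : ι) (k ℓ : Fin K), k ≠ ℓ → x j ∉ spanOf x (P k) ⊓ spanOf x (P ℓ)

/-- The set `𝒥(K, d, dmin)`: partitions of the index set into `K` pieces, each of size
greater than `dmin`, whose segment ranks sum to at most `d`. -/
def InJSet (x : ι → EuclideanSpace ℝ (Fin m)) (K d dmin : ℕ)
    (Q : Fin K → Finset ι) : Prop :=
  (∀ i : ι, ∃ k, i ∈ Q k) ∧ (∀ k ℓ, k ≠ ℓ → Disjoint (Q k) (Q ℓ)) ∧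
    (∀ k, dmin < (Q k).card) ∧ (∑ k, rOf x (Q k)) ≤ d

/-- On `W`, the projection onto `W ⊓ (W ⊓ S)ᗮ` vanishes exactly on `W ⊓ S`. -/
lemma starProjection_inf_orthogonal_eq_zero_iff
    {W S : Submodule ℝ (EuclideanSpace ℝ (Fin m))} {w : EuclideanSpace ℝ (Fin m)} (hw : w ∈ W) :
    (W ⊓ (W ⊓ S)ᗮ).starProjection w = 0 ↔ w ∈ S := by
  rw [Submodule.starProjection_apply_eq_zero_iff]
  constructor
  · intro h
    set N := W ⊓ S with hN
    have hn : N.starProjection w ∈ N := N.starProjection_apply_mem w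
    have hn' : w - N.starProjection w ∈ Nᗮ := N.sub_starProjection_mem_orthogonal w
    have hU : w - N.starProjection w ∈ W ⊓ Nᗮ := ⟨W.sub_mem hw hn.1, hn'⟩
    have h1 : inner ℝ (w - N.starProjection w) w = 0 := h _ hU
    have h2 : inner ℝ (w - N.starProjection w) (N.starProjection w) = 0 :=
      (Submodule.mem_orthogonal' N _).1 hn' _ hn
    have h3 : inner ℝ (w - N.starProjection w) (w - N.starProjection w) = 0 := by
      rw [inner_sub_right, h1, h2, sub_zero]
    rw [sub_eq_zero.1 (inner_self_eq_zero.1 h3)]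
    exact hn.2
  · intro h u hu
    exact (Submodule.mem_orthogonal' _ _).1 hu.2 w ⟨hw, h⟩

lemma zComp_eq_starProjection (x : ι → EuclideanSpace ℝ (Fin m))
    (W S : Submodule ℝ (EuclideanSpace ℝ (Fin m))) (i : ι) :
    zComp x W S i = (W ⊓ (W ⊓ S)ᗮ).starProjection (x i) := rfl

/-- The span of the components is the image of the span under the projection. -/
lemma spanOf_zComp (x : ι → EuclideanSpace ℝ (Fin m))
    (W S : Submodule ℝ (EuclideanSpace ℝ (Fin m))) (A : Finset ι) :
    spanOf (zComp x W S) A =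
      (spanOf x A).map ((W ⊓ (W ⊓ S)ᗮ).starProjection : _ →ₗ[ℝ] _) := by
  rw [spanOf, spanOf, Submodule.map_span, Set.image_image]
  rfl

lemma mem_spanOf_s10 (x : ι → EuclideanSpace ℝ (Fin m)) {A : Finset ι} {j : ι} (hj : j ∈ A) :
    x j ∈ spanOf x A :=
  Submodule.subset_span ⟨j, hj, rfl⟩

lemma spanOf_mono_s10 (x : ι → EuclideanSpace ℝ (Fin m)) {A B : Finset ι} (h : A ⊆ B) :
    spanOf x A ≤ spanOf x B :=
  Submodule.span_mono (Set.image_mono (by exact_mod_cast h))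

/-- For subspaces `V ≤ W`, a vector `w ∈ W` lies in `V ⊔ S` if and only if its component lies in
the image of `V`. -/
lemma starProjection_mem_map_iff {V W S : Submodule ℝ (EuclideanSpace ℝ (Fin m))}
    (hV : V ≤ W) {w : EuclideanSpace ℝ (Fin m)} (hw : w ∈ W) :
    (W ⊓ (W ⊓ S)ᗮ).starProjection w ∈
      V.map ((W ⊓ (W ⊓ S)ᗮ).starProjection : _ →ₗ[ℝ] _) ↔ w ∈ V ⊔ S := by
  have key (v) (hv : v ∈ V) : (W ⊓ (W ⊓ S)ᗮ).starProjection v =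
      (W ⊓ (W ⊓ S)ᗮ).starProjection w ↔ w - v ∈ S := by
    rw [← starProjection_inf_orthogonal_eq_zero_iff (W.sub_mem hw (hV hv)), map_sub, sub_eq_zero,
      eq_comm]
  rw [Submodule.mem_sup, Submodule.mem_map]
  constructor
  · rintro ⟨v, hv, h⟩
    exact ⟨v, hv, w - v, (key v hv).1 h, by simp⟩
  · rintro ⟨v, hv, s, hs, rfl⟩
    exact ⟨v, hv, (key v hv).2 (by simpa using hs)⟩

/-- In a nondegenerate family, a subfamily whose span contains a further vector of the family
spans everything. -/
lemma Nondeg.spanOf_eq [DecidableEq ι] {z : ι → EuclideanSpace ℝ (Fin m)} {A S : Finset ι} {j : ι}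
    (hz : Nondeg z S) (hA : A ⊆ S) (hj : j ∈ S) (hjA : j ∉ A) (hmem : z j ∈ spanOf z A) :
    spanOf z A = spanOf z S := by
  have hspan : spanOf z (insert j A) = spanOf z A := by
    rw [spanOf, Finset.coe_insert, Set.image_insert_eq]
    exact Submodule.span_insert_eq_span hmem
  have h1 := hz A hA
  have h2 := hz (insert j A) (Finset.insert_subset hj hA)
  rw [rOf, hspan, ← rOf, Finset.card_insert_of_notMem hjA] at h2
  have h3 : rOf z A = rOf z S := by omega
  exact Submodule.eq_of_le_of_finrank_eq (spanOf_mono_s10 z hA) h3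

/-- Extending an extendable piece `J_i` of a partition to
`J̃_i = J_i ∪ {j : x_j ∈ span(X_{J_i})}` either leaves each intersection with a minimal
segment unchanged, or absorbs the whole minimal segment:
`J̃_i ∩ J_k* = J_i ∩ J_k*` or `J̃_i ∩ J_k* = J_k*` for every `k`. -/
theorem extension_intersection [Fintype ι] [DecidableEq ι]
    (x : ι → EuclideanSpace ℝ (Fin m)) {K : ℕ} (P : Fin K → Finset ι)
    (hmss : IsMSSnp x P) (hnd : IntNondeg x P)
    (Q : Fin K → Finset ι)
    (hcov : ∀ j : ι, ∃ k, j ∈ Q k) (hdisj : ∀ k ℓ, k ≠ ℓ → Disjoint (Q k) (Q ℓ))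
    (i : Fin K)
    (hext : ∃ j : ι, j ∉ Q i ∧ x j ∈ spanOf x (Q i))
    (Jt : Finset ι) (hJt : ∀ j : ι, j ∈ Jt ↔ j ∈ Q i ∨ x j ∈ spanOf x (Q i)) :
    ∀ k : Fin K, Jt ∩ P k = Q i ∩ P k ∨ Jt ∩ P k = P k := by
  intro k
  by_cases hsub : ∀ j ∈ P k, x j ∈ spanOf x (Q i) → j ∈ Q i
  · left
    ext j
    simp only [Finset.mem_inter, hJt]
    have := hsub j
    tauto
  right
  push Not at hsub
  obtain ⟨j, hjP, hjV, hjQ⟩ := hsub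
  have hV : spanOf x (Q i) = spanOf x (Q i ∩ P k) ⊔ spanOf x (Q i \ P k) := by
    rw [spanOf, spanOf, spanOf, ← Submodule.span_union, ← Set.image_union, ← Finset.coe_union,
      Finset.union_comm, Finset.sdiff_union_inter]
  have hAW : spanOf x (Q i ∩ P k) ≤ spanOf x (P k) := spanOf_mono_s10 x Finset.inter_subset_right
  rw [Finset.inter_eq_right]
  intro l hl
  refine (hJt l).2 (Or.inr ?_)
  rw [hV]
  rcases hnd k (Q i \ P k) Finset.sdiff_disjoint with h0 | hz
  · have h := h0 l hl
    rw [zComp_eq_starProjection,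
      starProjection_inf_orthogonal_eq_zero_iff (mem_spanOf_s10 x hl)] at h
    exact Submodule.mem_sup_right h
  · rw [← starProjection_mem_map_iff hAW (mem_spanOf_s10 x hl), ← spanOf_zComp,
      hz.spanOf_eq Finset.inter_subset_right hjP (by simp [hjQ])]
    · exact mem_spanOf_s10 (zComp x _ _) hl
    · rw [spanOf_zComp, zComp_eq_starProjection,
        starProjection_mem_map_iff hAW (mem_spanOf_s10 x hjP), ← hV]
      exact hjV
end
end
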